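/- Contiguous relation for the full Kummer sums: Let a, b be complex numbers with Re(b) < 0, b ≠ 0, and 1 + a − b and a − b not nonpositive integers, and let M(a,b,k) = (a)_k (b)_k (−1)^k / ((1+a−b)_k k!). Then both series ∑_{k=0}^∞ M(a,b,k) and ∑_{k=0}^∞ M(a,b+1,k) converge, and (a − 2b) ∑_{k=0}^∞ M(a,b,k) + (−2a + 2b) ∑_{k=0}^∞ M(a,b+1,k) = 0; equivalently ∑_{k=0}^∞ M(a,b+1,k) = ((a/2 − b)/(a − b)) · ∑_{k=0}^∞ M(a,b,k). -/

import Mathlib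

open Complex Finset Filter Topology

/-- The Pochhammer symbol `(x)_k = x (x+1) ⋯ (x+k-1)`. -/
noncomputable def poch (x : ℂ) (k : ℕ) : ℂ := (ascPochhammer ℂ k).eval x

/-- The Kummer summand `M(a,b,k) = (a)_k (b)_k (-1)^k / ((1+a-b)_k k!)`. -/
noncomputable def kummerM (a b : ℂ) (k : ℕ) : ℂ :=
  poch a k * poch b k * (-1 : ℂ) ^ k / (poch (1 + a - b) k * (Nat.factorial k : ℂ))

theorem poch_succ (x : ℂ) (k : ℕ) : poch x (k + 1) = poch x k * (x + k) :=
  ascPochhammer_succ_eval k x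

theorem poch_zero (x : ℂ) : poch x 0 = 1 := by simp [poch]

theorem mul_poch_add_one (x : ℂ) (k : ℕ) : x * poch (x + 1) k = poch x k * (x + k) := by
  induction k with
  | zero => simp [poch_zero]
  | succ k ih =>
    rw [poch_succ, poch_succ, ← mul_assoc, ih]
    push_cast
    ring

theorem poch_eq_prod (x : ℂ) (k : ℕ) : poch x k = ∏ j ∈ range k, (x + j) := by
  induction k with
  | zero => simp [poch_zero]
  | succ k ih => rw [poch_succ, ih, prod_range_succ]

theorem poch_ne_zero {x : ℂ} (hx : ∀ m : ℕ, x ≠ -(m : ℂ)) (k : ℕ) : poch x k ≠ 0 := by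
  rw [poch_eq_prod]
  exact prod_ne_zero_iff.2 fun j _ h => hx j (eq_neg_of_add_eq_zero_left h)

/-- The inverse of Euler's Gamma sequence converges everywhere, poles of `Γ` included. -/
theorem tendsto_inv_GammaSeq (s : ℂ) :
    Tendsto (fun n => (GammaSeq s n)⁻¹) atTop (𝓝 (Gamma s)⁻¹) := by
  by_cases hs : ∀ m : ℕ, s ≠ -(m : ℂ)
  · exact (GammaSeq_tendsto_Gamma s).inv₀ (Gamma_ne_zero hs)
  · push Not at hs
    obtain ⟨m, rfl⟩ := hs
    rw [Gamma_neg_nat_eq_zero]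
    refine tendsto_const_nhds.congr' ?_
    filter_upwards [eventually_ge_atTop m] with n hn
    rw [GammaSeq, prod_eq_zero (mem_range.2 (Nat.lt_succ_of_le hn)) (by simp)]
    simp

/-- The telescoping certificate of the contiguous relation. -/
noncomputable def kummerCert (a b : ℂ) (k : ℕ) : ℂ :=
  k * (a - b + k) / b * kummerM a b k

theorem kummerM_add_one_right {a b : ℂ} (hb0 : b ≠ 0) (h2 : ∀ m : ℕ, a - b ≠ -(m : ℂ)) (k : ℕ) :
    kummerM a (b + 1) k = (b + k) * (a - b + k) / (b * (a - b)) * kummerM a b k := by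
  have hab : a - b ≠ 0 := by simpa using h2 0
  have habk : a - b + k ≠ 0 := fun h => h2 k (eq_neg_of_add_eq_zero_left h)
  have e1 : poch (b + 1) k = poch b k * (b + k) / b := by
    rw [← mul_poch_add_one, mul_div_cancel_left₀ _ hb0]
  have e2 : poch (1 + a - b) k = poch (a - b) k * (a - b + k) / (a - b) := by
    rw [← mul_poch_add_one, mul_div_cancel_left₀ _ hab]
    ring_nf
  have hp := poch_ne_zero h2 k
  have hk : (Nat.factorial k : ℂ) ≠ 0 := by exact_mod_cast k.factorial_ne_zero
  rw [kummerM, kummerM, e1, e2, show 1 + a - (b + 1) = a - b by ring]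
  field_simp

theorem kummerM_succ (a b : ℂ) (k : ℕ) :
    kummerM a b (k + 1) =
      -((a + k) * (b + k)) / ((1 + a - b + k) * (k + 1)) * kummerM a b k := by
  simp only [kummerM, poch_succ, Nat.factorial_succ, pow_succ]
  push_cast
  rw [div_mul_div_comm]
  congr 1 <;> ring

theorem kummerCert_succ_sub {a b : ℂ} (hb0 : b ≠ 0)
    (h1 : ∀ m : ℕ, 1 + a - b ≠ -(m : ℂ)) (h2 : ∀ m : ℕ, a - b ≠ -(m : ℂ)) (k : ℕ) :
    kummerCert a b (k + 1) - kummerCert a b k =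
      (a - 2 * b) * kummerM a b k + (-2 * a + 2 * b) * kummerM a (b + 1) k := by
  have hab : a - b ≠ 0 := by simpa using h2 0
  have habk : 1 + a - b + k ≠ 0 := fun h => h1 k (eq_neg_of_add_eq_zero_left h)
  have hk : (k : ℂ) + 1 ≠ 0 := by exact_mod_cast k.succ_ne_zero
  have e : kummerCert a b (k + 1) = -((a + k) * (b + k)) / b * kummerM a b k := by
    rw [kummerCert, kummerM_succ]
    push_cast
    rw [show a - b + ((k : ℂ) + 1) = 1 + a - b + k by ring]
    field_simp
  rw [e, kummerCert, kummerM_add_one_right hb0 h2]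
  field_simp
  ring

theorem kummerCert_succ_eq_GammaSeq {a b : ℂ} (h2 : ∀ m : ℕ, a - b ≠ -(m : ℂ))
    {n : ℕ} (hn : n ≠ 0) :
    kummerCert a b (n + 1) = (-1) ^ (n + 1) * (n : ℂ) ^ (2 * b) *
      ((a - b) / b * (GammaSeq (a - b) n * (GammaSeq a n)⁻¹ * (GammaSeq b n)⁻¹)) := by
  have hab : a - b ≠ 0 := by simpa using h2 0
  have habk : a - b + (n + 1 : ℕ) ≠ 0 := fun h => h2 (n + 1) (eq_neg_of_add_eq_zero_left h)
  have e2 : poch (1 + a - b) (n + 1) =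
      poch (a - b) (n + 1) * (a - b + (n + 1 : ℕ)) / (a - b) := by
    rw [← mul_poch_add_one, mul_div_cancel_left₀ _ hab]
    ring_nf
  have hp := poch_ne_zero h2 (n + 1)
  have hf : (Nat.factorial n : ℂ) ≠ 0 := by exact_mod_cast n.factorial_ne_zero
  have hn1 : (n : ℂ) + 1 ≠ 0 := by exact_mod_cast n.succ_ne_zero
  have hn0 : (n : ℂ) ≠ 0 := by exact_mod_cast hn
  have ha' : (n : ℂ) ^ a ≠ 0 := by simp [cpow_eq_zero_iff, hn0]
  have hb' : (n : ℂ) ^ b ≠ 0 := by simp [cpow_eq_zero_iff, hn0]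
  simp only [GammaSeq, ← poch_eq_prod, inv_div]
  rw [kummerCert, kummerM, e2, two_mul, cpow_add _ _ hn0, cpow_sub _ _ hn0, Nat.factorial_succ]
  push_cast at habk ⊢
  field_simp

theorem tendsto_kummerCert {a b : ℂ} (hb : b.re < 0) (h2 : ∀ m : ℕ, a - b ≠ -(m : ℂ)) :
    Tendsto (kummerCert a b) atTop (𝓝 0) := by
  rw [← tendsto_add_atTop_iff_nat 1]
  have hpow : Tendsto (fun n : ℕ => (-1 : ℂ) ^ (n + 1) * (n : ℂ) ^ (2 * b)) atTop (𝓝 0) := by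
    rw [tendsto_zero_iff_norm_tendsto_zero]
    have h := (tendsto_rpow_neg_atTop (y := -(2 * b.re)) (by linarith)).comp
      (tendsto_natCast_atTop_atTop (R := ℝ))
    refine h.congr' ?_
    filter_upwards [eventually_gt_atTop 0] with n hn
    rw [norm_mul, norm_pow, norm_neg, norm_one, one_pow, one_mul, norm_natCast_cpow_of_pos hn]
    simp
  have hG := (((GammaSeq_tendsto_Gamma (a - b)).mul (tendsto_inv_GammaSeq a)).mul
    (tendsto_inv_GammaSeq b)).const_mul ((a - b) / b)
  have h := hpow.mul hG
  rw [zero_mul] at h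
  refine h.congr' ?_
  filter_upwards [eventually_ne_atTop 0] with n hn
  exact (kummerCert_succ_eq_GammaSeq h2 hn).symm

theorem summable_kummerM {a b : ℂ} (hb : b.re < 0) (hb0 : b ≠ 0)
    (h2 : ∀ m : ℕ, a - b ≠ -(m : ℂ)) : Summable (kummerM a b) := by
  have hs : Summable fun n : ℕ => 2 * ‖b‖ * (1 / (n : ℝ) ^ 2) :=
    (Real.summable_one_div_nat_pow.2 one_lt_two).mul_left _
  refine hs.of_norm_bounded_eventually_nat ?_
  have hG := (tendsto_zero_iff_norm_tendsto_zero.1 (tendsto_kummerCert hb h2)).eventually_le_const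
    one_pos
  filter_upwards [hG, eventually_gt_atTop 0, eventually_ge_atTop ⌈2 * ‖a - b‖⌉₊] with n hGn hn hn2
  have hn0 : (0 : ℝ) < n := by exact_mod_cast hn
  have hnorm : (n : ℝ) / 2 ≤ ‖a - b + n‖ := by
    have h := norm_sub_le (a - b + n) (a - b)
    rw [add_sub_cancel_left, norm_natCast] at h
    have := Nat.ceil_le.1 hn2
    linarith
  rw [kummerCert, norm_mul, norm_div, norm_mul, norm_natCast] at hGn
  have hb' : 0 < ‖b‖ := norm_pos_iff.2 hb0
  have h : (n : ℝ) * (n / 2) / ‖b‖ * ‖kummerM a b n‖ ≤ 1 := le_trans (by gcongr) hGn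
  have e : (n : ℝ) * (n / 2) / ‖b‖ * ‖kummerM a b n‖ =
      ‖kummerM a b n‖ / (2 * ‖b‖ * (1 / (n : ℝ) ^ 2)) := by
    field_simp
  rwa [e, div_le_one (by positivity)] at h

/-- Contiguous relation for the full Kummer sums: for `Re b < 0` both series
`∑_k M(a,b,k)` and `∑_k M(a,b+1,k)` converge, `(a-2b) Σ₁ + (-2a+2b) Σ₂ = 0`, and
`Σ₂ = ((a/2-b)/(a-b)) Σ₁`. -/
theorem kummer_contiguous_sums (a b : ℂ) (hb : b.re < 0) (hb0 : b ≠ 0)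
    (h1 : ∀ m : ℕ, 1 + a - b ≠ -(m : ℂ))
    (h2 : ∀ m : ℕ, a - b ≠ -(m : ℂ)) :
    ∃ S₁ S₂ : ℂ,
      Tendsto (fun N : ℕ => ∑ k ∈ range N, kummerM a b k) atTop (𝓝 S₁) ∧
      Tendsto (fun N : ℕ => ∑ k ∈ range N, kummerM a (b + 1) k) atTop (𝓝 S₂) ∧
      (a - 2 * b) * S₁ + (-2 * a + 2 * b) * S₂ = 0 ∧
      S₂ = ((a / 2 - b) / (a - b)) * S₁ := by
  have hab : a - b ≠ 0 := by simpa using h2 0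
  have hS := (summable_kummerM hb hb0 h2).hasSum.tendsto_sum_nat
  have hpart : ∀ N : ℕ, ∑ k ∈ range N, kummerM a (b + 1) k =
      ((a - 2 * b) * ∑ k ∈ range N, kummerM a b k - kummerCert a b N) / (2 * (a - b)) := by
    intro N
    have h := sum_range_sub (kummerCert a b) N
    simp only [kummerCert_succ_sub hb0 h1 h2, sum_add_distrib, ← mul_sum] at h
    rw [show kummerCert a b 0 = 0 by simp [kummerCert], sub_zero] at h
    rw [← h]
    field_simp
    ring
  refine ⟨_, _, hS, ?_, ?_, rfl⟩
  · simp only [hpart]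
    convert ((hS.const_mul (a - 2 * b)).sub (tendsto_kummerCert hb h2)).div_const (2 * (a - b))
      using 2
    field_simp
    ring
  · field_simp
    ring
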